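/- (Theorem 2: minimal spreading maximizes the service rate under probabilistic access) Let m be a positive integer, μ > 0 a real number, and p ∈ [0,1) a real number. For every integer α ≥ 2, the average service rate of the (α, mα) quasi-symmetric allocation is strictly smaller than that of minimal spreading: ∑_{k=α}^{mα} C(mα,k) · (1−p)^k · p^{mα−k} · μ_s(α|k) < ∑_{k=1}^{m} μ·k · C(m,k) · (1−p)^k · p^{m−k}, where μ_s(α|k) = μ / (H_k − H_{k−α}) and H_k = ∑_{j=1}^k 1/j. -/

import Mathlib

/-- The `k`-th harmonic number `H k = ∑_{j=1}^k 1/j` as a real number. -/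
noncomputable def harmonicNumber (n : ℕ) : ℝ := ∑ j ∈ Finset.Icc 1 n, (1 : ℝ) / j

/-- The conditional service rate `μ_s(α|k) = μ / (H_k − H_{k−α})`. -/
noncomputable def condServiceRate (μ : ℝ) (α k : ℕ) : ℝ :=
  μ / (harmonicNumber k - harmonicNumber (k - α))

theorem sum_natCast_mul_choose_mul_pow (n : ℕ) (p : ℝ) :
    ∑ k ∈ Finset.Icc 1 n, (k : ℝ) * ((n.choose k : ℝ) * (1 - p) ^ k * p ^ (n - k)) =
      n * (1 - p) := by
  have h := congrArg (Polynomial.eval (1 - p)) (bernsteinPolynomial.sum_smul ℝ n)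
  simp only [Polynomial.eval_finsetSum, bernsteinPolynomial, nsmul_eq_mul, Polynomial.eval_mul,
    Polynomial.eval_natCast, Polynomial.eval_pow, Polynomial.eval_X, Polynomial.eval_sub,
    Polynomial.eval_one, sub_sub_cancel] at h
  rw [← h]
  refine Finset.sum_subset (fun k hk => ?_) (fun k hk hk' => ?_)
  · simp only [Finset.mem_Icc, Finset.mem_range] at *
    omega
  · have hk0 : k = 0 := by
      simp only [Finset.mem_Icc, Finset.mem_range] at *
      omega
    simp [hk0]

theorem harmonicNumber_succ (n : ℕ) :
    harmonicNumber (n + 1) = harmonicNumber n + 1 / ((n : ℝ) + 1) := by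
  simp [harmonicNumber, Finset.sum_Icc_succ_top]

theorem div_le_harmonicNumber_sub (a b : ℕ) :
    (b : ℝ) / (a + b) ≤ harmonicNumber (a + b) - harmonicNumber a := by
  induction b with
  | zero => simp
  | succ b ih =>
    rw [← add_assoc, harmonicNumber_succ]
    push_cast
    have h : (b : ℝ) / (a + b + 1) ≤ b / (a + b) := by
      rcases Nat.eq_zero_or_pos b with rfl | hb
      · simp
      · exact div_le_div_of_nonneg_left (by positivity) (by positivity) (by linarith)
    rw [← add_assoc, add_div]
    linarith

theorem div_lt_harmonicNumber_sub (a b : ℕ) (hb : 2 ≤ b) :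
    (b : ℝ) / (a + b) < harmonicNumber (a + b) - harmonicNumber a := by
  obtain ⟨c, rfl⟩ : ∃ c, b = c + 1 := ⟨b - 1, by omega⟩
  have hc : (0 : ℝ) < c := by
    have : 0 < c := by omega
    exact_mod_cast this
  have ih := div_le_harmonicNumber_sub a c
  rw [← add_assoc, harmonicNumber_succ]
  push_cast
  have h : (c : ℝ) / (a + c + 1) < c / (a + c) :=
    div_lt_div_of_pos_left hc (by positivity) (by linarith)
  rw [← add_assoc, add_div]
  linarith

theorem condServiceRate_lt {μ : ℝ} (hμ : 0 < μ) {α k : ℕ} (hα : 2 ≤ α) (hk : α ≤ k) :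
    condServiceRate μ α k < μ / α * k := by
  have h := div_lt_harmonicNumber_sub (k - α) α hα
  rw [← Nat.cast_add, Nat.sub_add_cancel hk] at h
  have hα0 : (0 : ℝ) < α := by
    have : 0 < α := by omega
    exact_mod_cast this
  have hk0 : (0 : ℝ) < k := lt_of_lt_of_le hα0 (by exact_mod_cast hk)
  calc condServiceRate μ α k < μ / (α / k) :=
        div_lt_div_of_pos_left hμ (by positivity) h
    _ = μ / α * k := by field_simp

/-- Theorem 2: in the probabilistic access model, minimal spreading (`α = 1`)
maximizes the average service rate: for every `α ≥ 2`, the average service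
rate of the `(α, mα)` quasi-symmetric allocation is strictly smaller than
that of minimal spreading. -/
theorem minimal_spreading_optimal_prob (m : ℕ) (hm : 0 < m)
    (μ p : ℝ) (hμ : 0 < μ) (hp0 : 0 ≤ p) (hp1 : p < 1) :
    ∀ α : ℕ, 2 ≤ α →
      ∑ k ∈ Finset.Icc α (m * α),
          ((Nat.choose (m * α) k : ℕ) : ℝ) * (1 - p) ^ k * p ^ (m * α - k)
            * condServiceRate μ α k
        < ∑ k ∈ Finset.Icc 1 m,
            μ * k * ((Nat.choose m k : ℕ) : ℝ) * (1 - p) ^ k * p ^ (m - k) := by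
  intro α hα
  have hα0 : (α : ℝ) ≠ 0 := by
    have : α ≠ 0 := by omega
    exact_mod_cast this
  have hq : 0 < 1 - p := sub_pos.2 hp1
  have hle : α ≤ m * α := Nat.le_mul_of_pos_left α hm
  let w : ℕ → ℝ := fun k => ((m * α).choose k : ℝ) * (1 - p) ^ k * p ^ (m * α - k)
  have hw : ∀ k, 0 ≤ w k := fun k => by positivity
  calc ∑ k ∈ Finset.Icc α (m * α), w k * condServiceRate μ α k
      < ∑ k ∈ Finset.Icc α (m * α), w k * (μ / α * k) := by
        refine Finset.sum_lt_sum (fun k hk => ?_) ⟨m * α, Finset.mem_Icc.2 ⟨hle, le_rfl⟩, ?_⟩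
        · exact mul_le_mul_of_nonneg_left
            (condServiceRate_lt hμ hα (Finset.mem_Icc.1 hk).1).le (hw k)
        · refine mul_lt_mul_of_pos_left (condServiceRate_lt hμ hα hle) ?_
          simp only [w, Nat.choose_self, Nat.sub_self, pow_zero]
          positivity
    _ ≤ ∑ k ∈ Finset.Icc 1 (m * α), w k * (μ / α * k) := by
        refine Finset.sum_le_sum_of_subset_of_nonneg
          (Finset.Icc_subset_Icc_left (by omega)) (fun k _ _ => ?_)
        exact mul_nonneg (hw k) (by positivity)
    _ = μ / α * ∑ k ∈ Finset.Icc 1 (m * α), (k : ℝ) * w k := by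
        rw [Finset.mul_sum]
        exact Finset.sum_congr rfl fun k _ => by ring
    _ = μ * (m * (1 - p)) := by
        rw [sum_natCast_mul_choose_mul_pow]
        push_cast
        field_simp
    _ = _ := by
        rw [← sum_natCast_mul_choose_mul_pow, Finset.mul_sum]
        exact Finset.sum_congr rfl fun k _ => by ring
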